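/- arXiv:math/0512116 — 5 statements merged into one kernel-verified Lean document; each statement's English description precedes it below -/
import Mathlib

section
/- Let m, α, β be integers with m ≥ 2 and α > β ≥ 1. If gcd(α, m·β) + gcd(β, m·α) = (m−1)·(α−β) + β + 2, then α = 4, β = 2 and m = 2, where gcd denotes the greatest common divisor. -/
theorem Int.gcd_mul_left_mul_mul_of_gcd_eq_one {a b : ℤ} (d m : ℤ) (hd : 0 ≤ d)
    (hab : Int.gcd a b = 1) :
    (Int.gcd (d * a) (m * (d * b)) : ℤ) = d * (Int.gcd a m : ℤ) := by
  rw [mul_left_comm, Int.gcd_mul_left, Int.gcd_mul_left_right_of_gcd_eq_one hab,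
    Nat.cast_mul, Int.natAbs_of_nonneg hd]

theorem stmt_8 (m α β : ℤ) (hm : m ≥ 2) (hαβ : α > β) (hβ : β ≥ 1)
    (h : (Int.gcd α (m * β) : ℤ) + (Int.gcd β (m * α) : ℤ) = (m - 1) * (α - β) + β + 2) :
    α = 4 ∧ β = 2 ∧ m = 2 := by
  obtain ⟨d, hd⟩ : ∃ d : ℤ, d = (Int.gcd α β : ℤ) := ⟨_, rfl⟩
  have hgpos : 0 < Int.gcd α β := Int.gcd_pos_of_ne_zero_right _ (by omega)
  have hdpos : 0 < d := by omega
  obtain ⟨a, b, hab, ha, hb⟩ := Int.exists_gcd_one hgpos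
  rw [← hd, mul_comm] at ha hb
  clear hd hgpos
  subst ha hb
  rw [Int.gcd_mul_left_mul_mul_of_gcd_eq_one d m hdpos.le hab,
    Int.gcd_mul_left_mul_mul_of_gcd_eq_one d m hdpos.le (Int.gcd_comm a b ▸ hab)] at h
  have hb : 0 < b := pos_of_mul_pos_right (by omega : 0 < d * b) hdpos.le
  have hba : b < a := lt_of_mul_lt_mul_left hαβ hdpos.le
  have hpm : (Int.gcd a m : ℤ) ∣ m := Int.gcd_dvd_right _ _
  have hpa : (Int.gcd a m : ℤ) ∣ a := Int.gcd_dvd_left _ _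
  have hqb : (Int.gcd b m : ℤ) ∣ b := Int.gcd_dvd_left _ _
  have hqm : (Int.gcd b m : ℤ) ∣ m := Int.gcd_dvd_right _ _
  generalize (Int.gcd a m : ℤ) = p at *
  generalize (Int.gcd b m : ℤ) = q at *
  have hp_le : p ≤ m := Int.le_of_dvd (by omega) hpm
  have hq_le : q ≤ b := Int.le_of_dvd hb hqb
  obtain ⟨k, hk⟩ : ∃ k, k = p + q - (m - 1) * (a - b) - b := ⟨_, rfl⟩
  have hdk : d * k = 2 := by rw [hk]; linear_combination h
  have hkpos : 0 < k := pos_of_mul_pos_right (by omega : 0 < d * k) hdpos.le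
  have ha : a = b + 1 := by
    by_contra hne
    have : 2 ≤ a - b := by omega
    nlinarith
  subst ha
  obtain rfl : k = 1 := by linarith
  obtain rfl : p = m := by linarith
  obtain rfl : q = b := by linarith
  have hq : q = 1 :=
    Int.eq_one_of_dvd_one hb.le ((Int.dvd_add_right dvd_rfl).mp (hqm.trans hpa))
  subst hq
  have := Int.le_of_dvd (by norm_num) hpa
  omega
end

section
/- Let w, u, α, β be integers with w ≥ 1, u ≤ −2 and α > β ≥ 1. If gcd(α, (w−u−1)·β) + gcd(β, (w−u−1)·α) = (w−u−2)·(α−β) + β + 2, then w = 1, u = −2, α = 4 and β = 2, where gcd denotes the greatest common divisor. -/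
theorem stmt_9 (w u α β : ℤ) (hw : w ≥ 1) (hu : u ≤ -2) (hαβ : α > β) (hβ : β ≥ 1)
    (h : (Int.gcd α ((w - u - 1) * β) : ℤ) + (Int.gcd β ((w - u - 1) * α) : ℤ) =
      (w - u - 2) * (α - β) + β + 2) :
    w = 1 ∧ u = -2 ∧ α = 4 ∧ β = 2 := by
  obtain ⟨k, hk⟩ : ∃ k, k = w - u - 1 := ⟨_, rfl⟩
  have hk2 : 2 ≤ k := by omega
  rw [← hk, show w - u - 2 = k - 1 by omega] at h
  have hd : 0 < Int.gcd α β := Int.gcd_pos_of_ne_zero_right _ (by omega)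
  obtain ⟨a, b, hab, ha, hb⟩ := Int.exists_gcd_one hd
  generalize Int.gcd α β = d at hd ha hb
  subst ha hb
  have hd' : (0 : ℤ) < d := by exact_mod_cast hd
  have hb1 : 0 < b := pos_of_mul_pos_left (by omega : 0 < b * (d : ℤ)) hd'.le
  have hlt : b < a := lt_of_mul_lt_mul_right hαβ hd'.le
  rw [← mul_assoc, ← mul_assoc, Int.gcd_mul_right, Int.gcd_mul_right, Int.natAbs_natCast] at h
  push_cast at h
  have hA : (Int.gcd a (k * b) : ℤ) ∣ k :=
    IsCoprime.dvd_of_dvd_mul_right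
      ((Int.isCoprime_iff_gcd_eq_one.2 hab).of_isCoprime_of_dvd_left (Int.gcd_dvd_left ..))
      (Int.gcd_dvd_right ..)
  have hAa : (Int.gcd a (k * b) : ℤ) ∣ a := Int.gcd_dvd_left ..
  have hB : (Int.gcd b (k * a) : ℤ) ∣ b := Int.gcd_dvd_left ..
  have hBk : (Int.gcd b (k * a) : ℤ) ∣ k :=
    IsCoprime.dvd_of_dvd_mul_right
      ((Int.isCoprime_iff_gcd_eq_one.2 hab).symm.of_isCoprime_of_dvd_left (Int.gcd_dvd_left ..))
      (Int.gcd_dvd_right ..)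
  generalize (Int.gcd a (k * b) : ℤ) = A at *
  generalize (Int.gcd b (k * a) : ℤ) = B at *
  have hAk := Int.le_of_dvd (by omega) hA
  have hBb := Int.le_of_dvd hb1 hB
  have hmul : (d : ℤ) * (A + B - (k - 1) * (a - b) - b) = 2 := by linear_combination h
  have hpos : 0 < A + B - (k - 1) * (a - b) - b :=
    pos_of_mul_pos_right (by omega : 0 < (d : ℤ) * (A + B - (k - 1) * (a - b) - b)) hd'.le
  have hdiff : a - b = 1 := by nlinarith
  have hone : A + B - (k - 1) * (a - b) - b = 1 := by rw [hdiff] at hpos ⊢; omega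
  rw [hone] at hmul
  rw [hdiff] at hone
  obtain rfl : A = k := by omega
  obtain rfl : B = b := by omega
  have hB1 : B ∣ 1 := by
    rw [← hdiff]
    exact dvd_sub (hBk.trans hAa) dvd_rfl
  have hB1' := Int.le_of_dvd one_pos hB1
  have hA2 := Int.le_of_dvd (by omega) hAa
  have hBe : B = 1 := by omega
  have hae : a = 2 := by omega
  subst hBe hae
  omega
end

section
/- Let m, α, β be integers with m ≥ 2 and α > β ≥ 1 such that gcd(α, m·β) + gcd(β, m·α) = (m−1)·(α−β) + β + 2, where gcd denotes the greatest common divisor. Then gcd(α, m·β) = α or gcd(β, m·α) = β. -/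
/-- A proper divisor of a positive integer is at most half of it. -/
theorem Int.two_mul_le_of_dvd_of_ne {a b : ℤ} (ha : 0 < a) (hb : b ∣ a) (hne : b ≠ a) :
    2 * b ≤ a := by
  obtain ⟨c, rfl⟩ := hb
  rcases le_or_gt b 0 with hb | hb
  · linarith
  · have hc : 0 < c := pos_of_mul_pos_right ha hb.le
    have hc1 : c ≠ 1 := fun h => hne (by simp [h])
    have hc2 : 2 ≤ c := by omega
    nlinarith

theorem stmt_10 (m α β : ℤ) (hm : m ≥ 2) (hαβ : α > β) (hβ : β ≥ 1)
    (h : (Int.gcd α (m * β) : ℤ) + (Int.gcd β (m * α) : ℤ) = (m - 1) * (α - β) + β + 2) :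
    (Int.gcd α (m * β) : ℤ) = α ∨ (Int.gcd β (m * α) : ℤ) = β := by
  by_contra! hne
  have h₁ := Int.two_mul_le_of_dvd_of_ne (by linarith) (Int.gcd_dvd_left α (m * β)) hne.1
  have h₂ := Int.two_mul_le_of_dvd_of_ne (by linarith) (Int.gcd_dvd_left β (m * α)) hne.2
  have hmul : 0 ≤ (m - 2) * (α - β) := mul_nonneg (by linarith) (by linarith)
  linarith
end

section
/- Let m, α, β be integers with m ≥ 2 and α > β ≥ 1. If gcd(α, m·β) = α and α + gcd(β, m·α) = (m−1)·(α−β) + β + 2, then α = 4, β = 2 and m = 2, where gcd denotes the greatest common divisor. -/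
theorem stmt_11 (m α β : ℤ) (hm : m ≥ 2) (hαβ : α > β) (hβ : β ≥ 1)
    (h1 : (Int.gcd α (m * β) : ℤ) = α)
    (h : α + (Int.gcd β (m * α) : ℤ) = (m - 1) * (α - β) + β + 2) :
    α = 4 ∧ β = 2 ∧ m = 2 := by
  have hdvd : α ∣ m * β := h1 ▸ Int.gcd_dvd_right α (m * β)
  have hg : 0 < Int.gcd α β := Int.gcd_pos_of_ne_zero_right α (by omega)
  obtain ⟨a, b, hab, ha, hb⟩ := Int.exists_gcd_one hg
  generalize Int.gcd α β = g at *
  have hg' : (0 : ℤ) < g := by exact_mod_cast hg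
  subst ha hb
  have hlt : b < a := lt_of_mul_lt_mul_right hαβ hg'.le
  have hb0 : 0 < b := pos_of_mul_pos_left (by omega) hg'.le
  have hcop : IsCoprime a b := Int.isCoprime_iff_gcd_eq_one.mpr hab
  have ham : a ∣ m := by
    refine hcop.dvd_of_dvd_mul_right (Int.dvd_of_mul_dvd_mul_right hg'.ne' ?_)
    rwa [mul_assoc]
  rw [← mul_assoc, Int.gcd_mul_right, Int.natAbs_natCast, Nat.cast_mul] at h
  have heb : (Int.gcd b (m * a) : ℤ) ∣ b := Int.gcd_dvd_left b (m * a)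
  have hema : (Int.gcd b (m * a) : ℤ) ∣ m * a := Int.gcd_dvd_right b (m * a)
  have he : 0 < (Int.gcd b (m * a) : ℤ) :=
    mod_cast Int.gcd_pos_of_ne_zero_left (m * a) hb0.ne'
  generalize (Int.gcd b (m * a) : ℤ) = e at *
  have hea : IsCoprime a e := hcop.of_isCoprime_of_dvd_right heb
  have hle : a * e ≤ m :=
    Int.le_of_dvd (by omega) (hea.mul_dvd ham (hea.symm.dvd_of_dvd_mul_right hema))
  have key : (e - (m - 2) * (a - b)) * (g : ℤ) = 2 := by linarith
  have hpos : 0 < e - (m - 2) * (a - b) := pos_of_mul_pos_left (by omega) hg'.le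
  have he1 : e = 1 := by nlinarith
  subst he1
  have hm2 : m = 2 := by nlinarith
  subst hm2
  have ha2 : a = 2 := by omega
  have hb1 : b = 1 := by omega
  subst ha2 hb1
  omega
end

section
/- Let m, α, β be integers with m ≥ 2 and α > β ≥ 1. If gcd(β, m·α) = β and gcd(α, m·β) + β = (m−1)·(α−β) + β + 2, then α = 4, β = 2 and m = 2, where gcd denotes the greatest common divisor. -/
theorem stmt_12 (m α β : ℤ) (hm : m ≥ 2) (hαβ : α > β) (hβ : β ≥ 1)
    (h2 : (Int.gcd β (m * α) : ℤ) = β)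
    (h : (Int.gcd α (m * β) : ℤ) + β = (m - 1) * (α - β) + β + 2) :
    α = 4 ∧ β = 2 ∧ m = 2 := by
  have hβα : β ∣ m * α := h2 ▸ Int.gcd_dvd_right β (m * α)
  have hg : (Int.gcd α (m * β) : ℤ) = (m - 1) * (α - β) + 2 := by linarith
  have hgα : (m - 1) * (α - β) + 2 ∣ α := hg ▸ Int.gcd_dvd_left α (m * β)
  have hgβ : (m - 1) * (α - β) + 2 ∣ m * β := hg ▸ Int.gcd_dvd_right α (m * β)
  obtain ⟨d, rfl⟩ : ∃ d, α = β + d := ⟨α - β, by ring⟩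
  rw [add_sub_cancel_left] at hgα hgβ
  have hd : 0 < d := by linarith
  have hgpos : 0 < (m - 1) * d + 2 := by nlinarith
  have hd2 : d = 2 := by
    obtain ⟨k, hk⟩ : (m - 1) * d + 2 ∣ m * d := by
      have := dvd_sub (hgα.mul_left m) hgβ
      rwa [mul_add, add_sub_cancel_left] at this
    have hk0 : 0 < k := pos_of_mul_pos_right (hk ▸ by positivity) hgpos.le
    have hk1 : k < 2 := by
      by_contra! hk2
      nlinarith [mul_le_mul_of_nonneg_left hk2 hgpos.le]
    obtain rfl : k = 1 := by lia
    linarith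
  subst hd2
  obtain ⟨t, ht⟩ := hgα
  have hβt : β = 2 * (m * t - 1) := by linarith
  have hdvd : m * t - 1 ∣ m := by
    have : β ∣ 2 * m := by
      have := dvd_sub hβα (Dvd.intro_left m rfl)
      rwa [mul_add, add_sub_cancel_left, mul_comm m 2] at this
    rw [hβt] at this
    exact Int.dvd_of_mul_dvd_mul_left two_ne_zero this
  have hone : m * t - 1 = 1 := by
    refine Int.eq_one_of_dvd_one (by linarith) ?_
    have := dvd_sub (hdvd.mul_right t) (dvd_refl (m * t - 1))
    rwa [sub_sub_cancel] at this
  have hm2 : m ≤ 2 := Int.le_of_dvd two_pos ⟨t, by linarith⟩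
  refine ⟨?_, ?_, ?_⟩ <;> linarith
end
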